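/- Let n = p1·p2·p3 where p1 < p2 < p3 are odd primes satisfying 2·p3 > p2·(p1 - 1). Then g(Ψ_n) = 2n/p1 - deg(Ψ_n) = 2·p2·p3 - deg(Ψ_n). -/

import Mathlib

open Polynomial

/-- The maximum gap `g(f)` between consecutive exponents occurring in a polynomial:
for `f = c₁x^{e₁} + ⋯ + cₜx^{eₜ}` with `cᵢ ≠ 0` and `e₁ < ⋯ < eₜ`, this is
`max_{1 ≤ i < t} (e_{i+1} - e_i)`, and `0` when `t = 1`. -/
noncomputable def maxGap (f : Polynomial ℤ) : ℕ :=
  (((f.support.sort (· ≤ ·)).zip (f.support.sort (· ≤ ·)).tail).map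
    (fun p => p.2 - p.1)).foldr max 0


/-- The `n`-th inverse cyclotomic polynomial `Ψₙ(x) = (xⁿ - 1)/Φₙ(x)`. -/
noncomputable def invCyclotomic (n : ℕ) : Polynomial ℤ :=
  (X ^ n - 1) /ₘ cyclotomic n ℤ

theorem List.Pairwise.mem_zip_tail_iff {l : List ℕ} (hl : l.Pairwise (· < ·)) (a b : ℕ) :
    (a, b) ∈ l.zip l.tail ↔ a ∈ l ∧ b ∈ l ∧ a < b ∧ ∀ c ∈ l, c ≤ a ∨ b ≤ c := by
  induction l with
  | nil => simp
  | cons x l ih =>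
    cases l with
    | nil => simp; omega
    | cons y l =>
      have ih := ih hl.of_cons
      simp only [List.tail_cons] at ih ⊢
      rw [List.zip_cons_cons, List.mem_cons, ih]
      simp only [List.pairwise_cons, List.mem_cons, forall_eq_or_imp, Prod.mk.injEq] at hl ⊢
      obtain ⟨⟨hxy, hx⟩, hy, -⟩ := hl
      constructor
      · rintro (⟨rfl, rfl⟩ | ⟨ha, hb, hab, hc, h⟩)
        · exact ⟨Or.inl rfl, Or.inr (Or.inl rfl), hxy, Or.inl le_rfl, Or.inr le_rfl,
            fun c hc => Or.inr (hy c hc).le⟩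
        · refine ⟨Or.inr ha, Or.inr hb, hab, Or.inl ?_, hc, h⟩
          rcases ha with rfl | ha
          · exact hxy.le
          · exact (hx a ha).le
      · rintro ⟨ha, hb, hab, -, hc, h⟩
        rcases ha with rfl | ha
        · left
          refine ⟨rfl, ?_⟩
          rcases hb with rfl | rfl | hb
          · omega
          · rfl
          · have := hy b hb
            omega
        · right
          refine ⟨ha, ?_, hab, hc, h⟩
          rcases hb with rfl | hb
          · rcases ha with rfl | ha
            · omega
            · have := hx a ha
              omega
          · exact hb

theorem List.foldr_max_le_iff (l : List ℕ) (G : ℕ) : l.foldr max 0 ≤ G ↔ ∀ x ∈ l, x ≤ G := by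
  induction l with
  | nil => simp
  | cons x l ih => simp [ih]

theorem maxGap_le_iff (f : ℤ[X]) (G : ℕ) :
    maxGap f ≤ G ↔ ∀ a ∈ f.support, ∀ b ∈ f.support, a < b →
      (∀ c ∈ f.support, c ≤ a ∨ b ≤ c) → b - a ≤ G := by
  have hl : (f.support.sort (· ≤ ·)).Pairwise (· < ·) := Finset.sortedLT_sort _ |>.pairwise
  simp only [maxGap, List.foldr_max_le_iff, List.mem_map, Prod.exists, hl.mem_zip_tail_iff,
    Finset.mem_sort]
  constructor
  · intro h a ha b hb hab hc
    exact h _ ⟨a, b, ⟨ha, hb, hab, hc⟩, rfl⟩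
  · rintro h _ ⟨a, b, ⟨ha, hb, hab, hc⟩, rfl⟩
    exact h a ha b hb hab hc

/-- The maximum gap is `b - a` as soon as `a < b` are consecutive exponents and every exponent
below the degree is followed by another one at distance at most `b - a`. -/
theorem maxGap_eq_sub {f : ℤ[X]} {a b : ℕ} (ha : a ∈ f.support) (hb : b ∈ f.support)
    (hab : a < b) (hc : ∀ c ∈ f.support, c ≤ a ∨ b ≤ c)
    (h : ∀ m < f.natDegree, ∃ c ∈ f.support, m < c ∧ c ≤ m + (b - a)) :
    maxGap f = b - a := by
  apply le_antisymm
  · rw [maxGap_le_iff]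
    intro x _ y hy hxy hxy'
    obtain ⟨c, hc, h1, h2⟩ := h x (hxy.trans_le (le_natDegree_of_mem_supp y hy))
    have := hxy' c hc
    omega
  · exact (maxGap_le_iff f _).1 le_rfl a ha b hb hab hc

theorem cyclotomic_mul_prime_identity {p q : ℕ} (hp : p.Prime) (hq : q.Prime) (hpq : p ≠ q) :
    cyclotomic (p * q) ℤ * (X ^ p - 1) * (X ^ q - 1) = (X ^ (p * q) - 1) * (X - 1) := by
  have : Fact p.Prime := ⟨hp⟩
  have h1 := cyclotomic_expand_eq_cyclotomic_mul (n := p) hq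
    (fun h => hpq ((Nat.prime_dvd_prime_iff_eq hq hp).1 h).symm) ℤ
  have h2 := cyclotomic_prime_mul_X_sub_one ℤ p
  have h3 := congrArg (expand ℤ q) h2
  simp only [map_mul, map_sub, map_pow, expand_X, map_one, ← pow_mul] at h3
  rw [mul_comm q p] at h3
  rw [← h2, ← h3, h1]
  ring

theorem eval_one_cyclotomic_mul_prime {p q : ℕ} (hp : p.Prime) (hq : q.Prime) (hpq : p ≠ q) :
    (cyclotomic (p * q) ℤ).eval 1 = 1 := by
  have : Fact p.Prime := ⟨hp⟩
  have h1 := congrArg (eval 1) (cyclotomic_expand_eq_cyclotomic_mul (n := p) hq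
    (fun h => hpq ((Nat.prime_dvd_prime_iff_eq hq hp).1 h).symm) ℤ)
  simp only [expand_eval, one_pow, eval_mul, eval_one_cyclotomic_prime] at h1
  have : (p : ℤ) ≠ 0 := mod_cast hp.ne_zero
  exact mul_right_cancel₀ this (by linarith)

/-- The polynomial `Φ_{pq}(x) (1 + x^r + ⋯ + x^{r(p-1)})`, of which `Ψ_{pqr}` consists of two
copies with opposite signs. -/
noncomputable def cyclotomicBlock (p q r : ℕ) : ℤ[X] :=
  cyclotomic (p * q) ℤ * ∑ i ∈ Finset.range p, X ^ (r * i)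

theorem sum_X_pow_mul_sub_one (p r : ℕ) :
    (∑ i ∈ Finset.range p, X ^ (r * i) : ℤ[X]) * (X ^ r - 1) = X ^ (p * r) - 1 := by
  simp only [pow_mul]
  rw [geom_sum_mul, ← pow_mul, ← pow_mul, mul_comm]

theorem X_pow_sub_one_ne_zero_int {k : ℕ} (hk : k ≠ 0) : (X ^ k - 1 : ℤ[X]) ≠ 0 :=
  (monic_X_pow_sub_C 1 hk).ne_zero

theorem invCyclotomic_eq {p q r : ℕ} (hp : p.Prime) (hq : q.Prime) (hr : r.Prime)
    (hpq : p < q) (hqr : q < r) :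
    invCyclotomic (p * q * r) = cyclotomicBlock p q r * (X ^ (q * r) - 1) := by
  have hdvd : ¬ r ∣ p * q := by
    rw [hr.dvd_mul]
    rintro (h | h)
    · exact absurd (Nat.le_of_dvd hp.pos h) (by omega)
    · exact absurd (Nat.le_of_dvd hq.pos h) (by omega)
  have h1 := cyclotomic_expand_eq_cyclotomic_mul (n := p * q) hr hdvd ℤ
  have h2 := congrArg (expand ℤ r) (cyclotomic_mul_prime_identity hp hq hpq.ne)
  simp only [map_mul, map_sub, map_pow, expand_X, map_one, ← pow_mul] at h2
  rw [mul_comm r p, mul_comm r q, mul_comm r (p * q), h1, ← sum_X_pow_mul_sub_one] at h2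
  have h3 : X ^ (p * q * r) - 1 =
      cyclotomic (p * q * r) ℤ * (cyclotomicBlock p q r * (X ^ (q * r) - 1)) := by
    apply mul_right_cancel₀ (X_pow_sub_one_ne_zero_int hr.ne_zero)
    rw [← h2, cyclotomicBlock]
    ring
  rw [invCyclotomic, h3, mul_divByMonic_cancel_left _ (cyclotomic.monic _ _)]

theorem reverse_X_pow_sub_one (k : ℕ) :
    (X ^ k - 1 : ℤ[X]).reverse = -(X ^ k - 1) := by
  have h := natDegree_X_pow_sub_C (n := k) (r := (1 : ℤ))
  rw [C_1] at h
  have := reflect_sub (X ^ k : ℤ[X]) 1 k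
  rw [reverse, h, this, ← one_mul (X ^ k), ← C_1, reflect_C_mul_X_pow, reflect_C]
  simp [revAt_le]

section Block

variable {p q r : ℕ}

theorem monic_sum_X_pow_mul (hp : p ≠ 0) (hr : r ≠ 0) :
    (∑ i ∈ Finset.range p, X ^ (r * i) : ℤ[X]).Monic := by
  refine Monic.of_mul_monic_right (monic_X_pow_sub_C (1 : ℤ) hr) ?_
  rw [C_1, sum_X_pow_mul_sub_one]
  exact monic_X_pow_sub_C 1 (mul_ne_zero hp hr)

theorem monic_cyclotomicBlock (hp : p ≠ 0) (hr : r ≠ 0) : (cyclotomicBlock p q r).Monic :=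
  (cyclotomic.monic _ ℤ).mul (monic_sum_X_pow_mul hp hr)

theorem cyclotomicBlock_identity (hp : p.Prime) (hq : q.Prime) (hpq : p ≠ q) :
    cyclotomicBlock p q r * ((X ^ p - 1) * (X ^ q - 1) * (X ^ r - 1)) =
      (X ^ (p * q) - 1) * (X ^ 1 - 1) * (X ^ (p * r) - 1) := by
  rw [pow_one, ← cyclotomic_mul_prime_identity hp hq hpq, ← sum_X_pow_mul_sub_one,
    cyclotomicBlock]
  ring

theorem reverse_cyclotomicBlock (hp : p.Prime) (hq : q.Prime) (hr : r ≠ 0) (hpq : p ≠ q) :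
    (cyclotomicBlock p q r).reverse = cyclotomicBlock p q r := by
  have hp0 := hp.ne_zero
  have hq0 := hq.ne_zero
  have h1 := cyclotomicBlock_identity (r := r) hp hq hpq
  have h2 := congrArg reverse h1
  simp only [reverse_mul_of_domain, reverse_X_pow_sub_one] at h2
  refine mul_right_cancel₀ (mul_ne_zero (mul_ne_zero (X_pow_sub_one_ne_zero_int hp0)
    (X_pow_sub_one_ne_zero_int hq0)) (X_pow_sub_one_ne_zero_int hr)) (Eq.trans ?_ h1.symm)
  linear_combination -h2

theorem natDegree_cyclotomic_mul_prime (hp : p.Prime) (hq : q.Prime) (hpq : p ≠ q) :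
    (cyclotomic (p * q) ℤ).natDegree = (p - 1) * (q - 1) := by
  rw [natDegree_cyclotomic, Nat.totient_mul ((Nat.coprime_primes hp hq).2 hpq),
    Nat.totient_prime hp, Nat.totient_prime hq]

theorem natDegree_cyclotomicBlock (hp : p.Prime) (hq : q.Prime) (hr : r ≠ 0) (hpq : p ≠ q) :
    (cyclotomicBlock p q r).natDegree = (p - 1) * (q - 1) + r * (p - 1) := by
  have hs := monic_sum_X_pow_mul hp.ne_zero hr
  have hx := monic_X_pow_sub_C (1 : ℤ) hr
  have h := congrArg natDegree (sum_X_pow_mul_sub_one p r)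
  rw [← C_1, hs.natDegree_mul hx, natDegree_X_pow_sub_C, natDegree_X_pow_sub_C] at h
  rw [cyclotomicBlock, (cyclotomic.monic _ ℤ).natDegree_mul hs,
    natDegree_cyclotomic_mul_prime hp hq hpq, Nat.mul_sub r, mul_comm r p, mul_one, ← h, Nat.add_sub_cancel]

theorem coeff_cyclotomicBlock (m : ℕ) :
    (cyclotomicBlock p q r).coeff m =
      ∑ i ∈ Finset.range p, if r * i ≤ m then (cyclotomic (p * q) ℤ).coeff (m - r * i) else 0 := by
  simp [cyclotomicBlock, Finset.mul_sum, coeff_mul_X_pow']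

theorem coeff_cyclotomicBlock_of_lt (hp : 0 < p) {j : ℕ} (hj : j < r) :
    (cyclotomicBlock p q r).coeff j = (cyclotomic (p * q) ℤ).coeff j := by
  rw [coeff_cyclotomicBlock, Finset.sum_eq_single_of_mem 0 (by simpa using hp)]
  · simp
  · intro i _ hi
    rw [if_neg]
    have := Nat.mul_le_mul_left r (Nat.one_le_iff_ne_zero.2 hi)
    omega

theorem coeff_cyclotomicBlock_add (hD : (cyclotomic (p * q) ℤ).natDegree < 2 * r) {k j : ℕ}
    (hj : j < r) (hk : k + 1 < p) :
    (cyclotomicBlock p q r).coeff (r * (k + 1) + j) =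
      (cyclotomic (p * q) ℤ).coeff j + (cyclotomic (p * q) ℤ).coeff (r + j) := by
  rw [coeff_cyclotomicBlock, Finset.sum_eq_add_of_mem (k + 1) k (by simpa using hk)
    (by simp; omega) (by omega)]
  · have h : r * (k + 1) + j - r * k = r + j := by rw [mul_add, mul_one]; omega
    rw [if_pos (by omega), if_pos (by rw [mul_add]; omega), h, Nat.add_sub_cancel_left]
  · rintro i _ ⟨h1, h2⟩
    split_ifs with h
    · apply coeff_eq_zero_of_natDegree_lt
      rcases lt_or_gt_of_ne h1 with hi | hi
      · obtain ⟨d, rfl⟩ := Nat.exists_eq_add_of_lt (show i < k by omega)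
        have : r * (i + d + 1 + 1) = r * i + 2 * r + r * d := by ring
        omega
      · have := Nat.mul_le_mul_left r (show k + 1 + 1 ≤ i from hi)
        rw [mul_add r (k + 1)] at this
        omega
    · rfl

theorem coeff_cyclotomicBlock_last (hp : 0 < p)
    (hD : (cyclotomic (p * q) ℤ).natDegree < 2 * r) {j : ℕ} (hj : j < r) :
    (cyclotomicBlock p q r).coeff (r * p + j) = (cyclotomic (p * q) ℤ).coeff (r + j) := by
  obtain ⟨k, rfl⟩ : ∃ k, p = k + 1 := Nat.exists_eq_add_of_le' hp
  have h (i : ℕ) : r * (i + 1) = r * i + r := by ring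
  rw [coeff_cyclotomicBlock, Finset.sum_eq_single_of_mem k (by simp)]
  · rw [h, if_pos (by omega)]
    congr 1
    omega
  · intro i hi hik
    simp only [Finset.mem_range] at hi hik ⊢
    split_ifs
    · apply coeff_eq_zero_of_natDegree_lt
      obtain ⟨d, rfl⟩ := Nat.exists_eq_add_of_lt (show i < k by omega)
      have : r * (i + d + 1 + 1) = r * i + 2 * r + r * d := by ring
      omega
    · rfl

theorem exists_coeff_add_coeff_ne_zero (hp : p.Prime) (hq : q.Prime) (hpq : p ≠ q)
    (hD : (cyclotomic (p * q) ℤ).natDegree < 2 * r) :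
    ∃ j < r, (cyclotomic (p * q) ℤ).coeff j + (cyclotomic (p * q) ℤ).coeff (r + j) ≠ 0 := by
  by_contra! h
  have h1 := eval_one_cyclotomic_mul_prime hp hq hpq
  rw [eval_eq_sum_range' hD, two_mul, Finset.sum_range_add, ← Finset.sum_add_distrib,
    Finset.sum_eq_zero] at h1
  · exact zero_ne_one h1
  · intro j hj
    simpa using h j (Finset.mem_range.1 hj)

theorem sub_mem_support_cyclotomicBlock (hp : p.Prime) (hq : q.Prime) (hr : r ≠ 0) (hpq : p ≠ q)
    {m : ℕ} (hm : m ∈ (cyclotomicBlock p q r).support) :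
    (cyclotomicBlock p q r).natDegree - m ∈ (cyclotomicBlock p q r).support := by
  have hle := le_natDegree_of_mem_supp m hm
  rw [mem_support_iff] at hm ⊢
  rwa [← revAt_le hle, ← coeff_reverse, reverse_cyclotomicBlock hp hq hr hpq]

theorem natDegree_mem_support_cyclotomicBlock (hp : p ≠ 0) (hr : r ≠ 0) :
    (cyclotomicBlock p q r).natDegree ∈ (cyclotomicBlock p q r).support := by
  rw [mem_support_iff, (monic_cyclotomicBlock hp hr).coeff_natDegree]
  exact one_ne_zero

theorem zero_mem_support_cyclotomicBlock (hp : p.Prime) (hq : q.Prime) (hr : r ≠ 0)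
    (hpq : p ≠ q) : 0 ∈ (cyclotomicBlock p q r).support := by
  simpa using sub_mem_support_cyclotomicBlock hp hq hr hpq
    (natDegree_mem_support_cyclotomicBlock hp.ne_zero hr)

/-- All gaps of the block `Φ_{pq}(x) (1 + x^r + ⋯ + x^{r(p-1)})` are at most `r`. -/
theorem exists_mem_support_cyclotomicBlock (hp : p.Prime) (hq : q.Prime) (hr : r ≠ 0)
    (hpq : p ≠ q) (hD : (p - 1) * (q - 1) < 2 * r) {m : ℕ}
    (hm : m < (cyclotomicBlock p q r).natDegree) :
    ∃ b ∈ (cyclotomicBlock p q r).support, m < b ∧ b ≤ m + r := by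
  have hE := natDegree_cyclotomicBlock hp hq hr hpq
  have hdeg := natDegree_cyclotomic_mul_prime hp hq hpq
  have hD' : (cyclotomic (p * q) ℤ).natDegree < 2 * r := hdeg ▸ hD
  set E := (cyclotomicBlock p q r).natDegree
  set S := (cyclotomicBlock p q r).support
  set D := (p - 1) * (q - 1)
  have hsymm : ∀ m ∈ S, E - m ∈ S := fun m hm =>
    sub_mem_support_cyclotomicBlock hp hq hr hpq hm
  have hES : E ∈ S := natDegree_mem_support_cyclotomicBlock hp.ne_zero hr
  have hle : ∀ m ∈ S, m ≤ E := fun m hm => le_natDegree_of_mem_supp m hm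
  obtain ⟨j, hj, hjne⟩ := exists_coeff_add_coeff_ne_zero hp hq hpq hD'
  have hmid : ∀ k, k + 1 < p → r * (k + 1) + j ∈ S := fun k hk => by
    rwa [mem_support_iff, coeff_cyclotomicBlock_add hD' hj hk]
  obtain ⟨s, rfl⟩ := Nat.exists_eq_add_of_le' hp.two_le
  have hrp : r * (s + 2) = r * (s + 1) + r := by ring
  have hs : s + 2 - 1 = s + 1 := rfl
  rw [hs] at hE
  have h1 : r + j ∈ S := by simpa using hmid 0 (by omega)
  have h2 : r * (s + 1) + j ∈ S := hmid s (by omega)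
  have hlow : ∀ m < r + j, ∃ b ∈ S, m < b ∧ b ≤ m + r := by
    intro m hm
    by_cases hcj : (cyclotomic ((s + 2) * q) ℤ).coeff j = 0
    · have hcr : (cyclotomic ((s + 2) * q) ℤ).coeff (r + j) ≠ 0 := by
        rwa [hcj, zero_add] at hjne
      have hrj : r + j ≤ D := hdeg ▸ le_natDegree_of_ne_zero hcr
      have h3 : r * (s + 2) + j ∈ S := by
        rwa [mem_support_iff, coeff_cyclotomicBlock_last hp.pos hD' hj]
      have h4 := hsymm _ h2
      have h5 := hsymm _ h3
      rcases lt_or_ge m (E - (r * (s + 2) + j)) with h | h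
      · exact ⟨_, h5, h, by omega⟩
      rcases lt_or_ge m (E - (r * (s + 1) + j)) with h' | h'
      · exact ⟨_, h4, h', by omega⟩
      · exact ⟨_, h1, hm, by omega⟩
    · rcases lt_or_ge m j with h | h
      · refine ⟨j, ?_, h, by omega⟩
        rwa [mem_support_iff, coeff_cyclotomicBlock_of_lt hp.pos hj]
      · exact ⟨_, h1, hm, by omega⟩
  rcases lt_or_ge m (r + j) with h | h
  · exact hlow m h
  rcases lt_or_ge m (r * (s + 1) + j) with h' | h'
  · have hdiv := Nat.div_add_mod (m - j) r
    have hmod := Nat.mod_lt (m - j) (Nat.pos_of_ne_zero hr)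
    set k := (m - j) / r
    have hk : k < s + 1 := Nat.lt_of_mul_lt_mul_left (a := r) (by omega)
    refine ⟨_, hmid k (by omega), ?_, ?_⟩ <;> rw [mul_add r k] <;> omega
  · rcases le_or_gt E (m + r) with h3 | h3
    · exact ⟨E, hES, hm, h3⟩
    · obtain ⟨b, hb, hb1, hb2⟩ := hlow (E - m - r - 1) (by omega)
      exact ⟨E - b, hsymm b hb, by omega, by omega⟩

end Block

/-- The largest gap of `f * (x^N - 1)` for a polynomial `f` of degree less than `N` with nonzero
constant coefficient is the one in the middle, if it is at least as large as all gaps of `f`. -/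
theorem maxGap_mul_X_pow_sub_one {f : ℤ[X]} {N : ℕ} (hN : f.natDegree < N)
    (h0 : 0 ∈ f.support)
    (hgap : ∀ m < f.natDegree, ∃ b ∈ f.support, m < b ∧ b ≤ m + (N - f.natDegree)) :
    maxGap (f * (X ^ N - 1)) = N - f.natDegree := by
  have hf : f ≠ 0 := by
    rintro rfl
    simp at h0
  have hlow : ∀ m < N, (f * (X ^ N - 1)).coeff m = -f.coeff m := by
    intro m hm
    rw [mul_sub, coeff_sub, coeff_mul_X_pow', if_neg (by omega), mul_one, zero_sub]
  have hhigh : ∀ m, (f * (X ^ N - 1)).coeff (m + N) = f.coeff m := by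
    intro m
    rw [mul_sub, coeff_sub, coeff_mul_X_pow, mul_one,
      coeff_eq_zero_of_natDegree_lt (n := m + N) (by omega), sub_zero]
  have hlow' : ∀ m ∈ f.support, m ∈ (f * (X ^ N - 1)).support := by
    intro m hm
    have := le_natDegree_of_mem_supp m hm
    rw [mem_support_iff] at hm ⊢
    rwa [hlow m (by omega), neg_ne_zero]
  have hhigh' : ∀ m ∈ f.support, m + N ∈ (f * (X ^ N - 1)).support := by
    intro m hm
    rw [mem_support_iff] at hm ⊢
    rwa [hhigh]
  have hlast : f.natDegree ∈ f.support := by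
    rw [mem_support_iff]
    exact leadingCoeff_ne_zero.2 hf
  have hdeg : (f * (X ^ N - 1)).natDegree = f.natDegree + N := by
    rw [natDegree_mul hf (X_pow_sub_one_ne_zero_int (by omega)), ← C_1, natDegree_X_pow_sub_C]
  refine maxGap_eq_sub (hlow' _ hlast) (by simpa using hhigh' 0 h0) hN ?_ ?_
  · intro c hc
    by_contra! h
    rw [mem_support_iff, hlow c h.2, neg_ne_zero] at hc
    exact hc (coeff_eq_zero_of_natDegree_lt h.1)
  · intro m hm
    rw [hdeg] at hm
    rcases lt_or_ge m f.natDegree with h | h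
    · obtain ⟨b, hb, hb'⟩ := hgap m h
      exact ⟨b, hlow' b hb, hb'⟩
    rcases lt_or_ge m N with h' | h'
    · exact ⟨0 + N, hhigh' 0 h0, by omega, by omega⟩
    · obtain ⟨b, hb, hb'⟩ := hgap (m - N) (by omega)
      exact ⟨b + N, hhigh' b hb, by omega, by omega⟩

theorem maxGap_invCyclotomic_of_D2 (p1 p2 p3 n : ℕ)
    (hp1 : p1.Prime) (hp2 : p2.Prime) (hp3 : p3.Prime)
    (hodd1 : Odd p1) (hodd2 : Odd p2) (hodd3 : Odd p3)
    (h12 : p1 < p2) (h23 : p2 < p3) (hn : n = p1 * p2 * p3)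
    (hD2 : p2 * (p1 - 1) < 2 * p3) :
    (maxGap (invCyclotomic n) : ℤ) =
      2 * p2 * p3 - (invCyclotomic n).natDegree := by
  subst hn
  have hr := hp3.ne_zero
  have hE := natDegree_cyclotomicBlock hp1 hp2 hr h12.ne
  obtain ⟨a, rfl⟩ := Nat.exists_eq_add_of_le' hp1.one_le
  obtain ⟨d, rfl⟩ : ∃ d, p2 = a + 1 + 2 + d := by
    obtain ⟨x, hx⟩ := hodd1
    obtain ⟨y, hy⟩ := hodd2
    exact ⟨p2 - (a + 1 + 2), by omega⟩
  have hq1 : a + 1 + 2 + d - 1 = a + 2 + d := by omega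
  rw [Nat.add_sub_cancel] at hD2
  rw [Nat.add_sub_cancel, hq1] at hE
  have hD : a * (a + 2 + d) < 2 * p3 := by nlinarith
  have hGap : (cyclotomicBlock (a + 1) (a + 1 + 2 + d) p3).natDegree + p3 <
      (a + 1 + 2 + d) * p3 := by
    rw [hE]
    nlinarith [Nat.zero_le (d * p3)]
  have hdeg : (invCyclotomic ((a + 1) * (a + 1 + 2 + d) * p3)).natDegree =
      (cyclotomicBlock (a + 1) (a + 1 + 2 + d) p3).natDegree + (a + 1 + 2 + d) * p3 := by
    rw [invCyclotomic_eq hp1 hp2 hp3 h12 h23,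
      natDegree_mul (monic_cyclotomicBlock hp1.ne_zero hr).ne_zero
        (X_pow_sub_one_ne_zero_int (by positivity)), ← C_1, natDegree_X_pow_sub_C]
  rw [hdeg, invCyclotomic_eq hp1 hp2 hp3 h12 h23, maxGap_mul_X_pow_sub_one (by omega)
    (zero_mem_support_cyclotomicBlock hp1 hp2 hr h12.ne)]
  · push_cast [Nat.cast_sub (show (cyclotomicBlock (a + 1) (a + 1 + 2 + d) p3).natDegree ≤
      (a + 1 + 2 + d) * p3 by omega)]
    ring
  · intro m hm
    obtain ⟨b, hb, h1, h2⟩ := exists_mem_support_cyclotomicBlock hp1 hp2 hr h12.ne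
      (by rwa [Nat.add_sub_cancel, hq1]) hm
    exact ⟨b, hb, h1, by omega⟩
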